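/- arXiv:2305.03516 — 2 statements merged into one kernel-verified Lean document; each statement's English description precedes it below -/
import Mathlib

section
/- If f is a maximum boundary independent broadcast on a tree T (with at least 2 vertices), then no leaf of T hears a broadcast from any non-leaf vertex; that is, for every leaf u and every broadcasting vertex v that is not a leaf, d_T(u,v) > f(v). -/
open SimpleGraph Finset

/-- The eccentricity of a vertex: the maximum distance to any other vertex. -/
noncomputable def ecc {V : Type*} [Fintype V] (G : SimpleGraph V) (v : V) : ℕ :=
  Finset.univ.sup fun u => G.dist v u

/-- A broadcast: each vertex broadcasts with strength at most its eccentricity. -/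
def IsBroadcast {V : Type*} [Fintype V] (G : SimpleGraph V) (f : V → ℕ) : Prop :=
  ∀ v, f v ≤ ecc G v

/-- A boundary independent broadcast. -/
def IsBnIndep {V : Type*} [Fintype V] (G : SimpleGraph V) (f : V → ℕ) : Prop :=
  IsBroadcast G f ∧ ∀ u v, u ≠ v → 1 ≤ f u → 1 ≤ f v → f u + f v ≤ G.dist u v

/-- The maximum cost of a boundary independent broadcast. -/
noncomputable def alphaBn {V : Type*} [Fintype V] (G : SimpleGraph V) : ℕ :=
  sSup {k | ∃ f : V → ℕ, IsBnIndep G f ∧ ∑ v, f v = k}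

/-- The independence number. -/
noncomputable def indepNum {V : Type*} [Fintype V] (G : SimpleGraph V) : ℕ :=
  sSup {k | ∃ s : Finset V, (∀ u ∈ s, ∀ v ∈ s, u ≠ v → ¬ G.Adj u v) ∧ s.card = k}

lemma bn_mem_geod {V : Type*} {T : SimpleGraph V} {x a c : V}
    (p : T.Walk x a) (hp : p.length = T.dist x a) (hc : c ∈ p.support) :
    T.dist x c + T.dist c a ≤ T.dist x a := by
  classical
  have h1 := congrArg SimpleGraph.Walk.length (p.take_spec hc)
  rw [SimpleGraph.Walk.length_append] at h1
  have h2 := T.dist_le (p.takeUntil c hc)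
  have h3 := T.dist_le (p.dropUntil c hc)
  omega

lemma bn_interm {V : Type*} {T : SimpleGraph V} (hT : T.Connected) (v w : V) (m : ℕ)
    (hm : m ≤ T.dist v w) : ∃ z, T.dist v z = m ∧ T.dist v w = m + T.dist z w := by
  obtain ⟨p, hp⟩ := hT.exists_walk_length_eq_dist v w
  have h1 := T.dist_le (p.take m)
  have h2 := T.dist_le (p.drop m)
  have h3 := hT.dist_triangle (u := v) (v := p.getVert m) (w := w)
  rw [SimpleGraph.Walk.take_length] at h1
  rw [SimpleGraph.Walk.drop_length] at h2
  exact ⟨p.getVert m, by omega, by omega⟩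

/-- Distances across an edge of a tree. -/
lemma bn_edge {V : Type*} {T : SimpleGraph V} (hT : T.IsTree) {a b x w : V} (hab : T.Adj a b)
    (hx : T.dist x b = T.dist x a + 1) (hw : T.dist a w = T.dist b w + 1) :
    T.dist x w = T.dist x a + 1 + T.dist b w := by
  obtain ⟨p, hp⟩ := hT.connected.exists_walk_length_eq_dist x a
  obtain ⟨q, hq⟩ := hT.connected.exists_walk_length_eq_dist b w
  obtain ⟨r, hr⟩ := hT.connected.exists_walk_length_eq_dist x w
  have hpath : (p.append (SimpleGraph.Walk.cons hab q)).IsPath := by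
    rw [SimpleGraph.Walk.isPath_def, SimpleGraph.Walk.support_append]
    simp only [SimpleGraph.Walk.support_cons, List.tail_cons]
    rw [List.nodup_append]
    refine ⟨(p.isPath_of_length_eq_dist hp).support_nodup,
      (q.isPath_of_length_eq_dist hq).support_nodup, ?_⟩
    rintro c hc c' hc' rfl
    have h1 := bn_mem_geod p hp hc
    have h2 := bn_mem_geod q hq hc'
    have h3 := hT.connected.dist_triangle (u := x) (v := c) (w := b)
    have h4 := hT.connected.dist_triangle (u := a) (v := c) (w := w)
    have h5 := T.dist_comm (u := c) (v := b)
    have h6 := T.dist_comm (u := c) (v := a)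
    omega
  have := (hT.existsUnique_path x w).unique hpath (r.isPath_of_length_eq_dist hr)
  rw [← hr, ← this]
  simp only [SimpleGraph.Walk.length_append, SimpleGraph.Walk.length_cons]
  omega

/-- Exit vertex of the ball of radius `k` around `v` toward `w`. -/
lemma bn_exit {V : Type*} {T : SimpleGraph V} (hT : T.IsTree) (v w : V) (k : ℕ)
    (hk : k ≤ T.dist v w) : ∃ y, T.dist v y = k ∧ T.dist v w = k + T.dist y w ∧
      ∀ x, T.dist v x ≤ k → T.dist x w = T.dist x y + T.dist y w := by
  obtain ⟨y, h1, h2⟩ := bn_interm hT.connected v w k hk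
  refine ⟨y, h1, h2, fun x hx => ?_⟩
  rcases Nat.eq_zero_or_pos (T.dist y w) with h0 | h0
  · have := (hT.connected.dist_eq_zero_iff).1 h0
    subst this; simp
  obtain ⟨y', h3, h4⟩ := bn_interm hT.connected y w 1 h0
  have hadj : T.Adj y y' := SimpleGraph.dist_eq_one_iff_adj.1 h3
  have hv : T.dist v y' = T.dist v y + 1 := by
    have e1 := hT.connected.dist_triangle (u := v) (v := y') (w := w)
    have e2 := hT.connected.dist_triangle (u := v) (v := y) (w := y')
    omega
  have hw : T.dist y w = T.dist y' w + 1 := by omega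
  rcases hT.dist_eq_dist_add_one_of_adj x hadj with h | h
  · exfalso
    have := bn_edge hT hadj hv (w := x) (by rw [T.dist_comm (u := y), T.dist_comm (u := y')]; exact h)
    omega
  · have := bn_edge hT hadj h hw
    omega

lemma bn_le_ecc {V : Type*} [Fintype V] (G : SimpleGraph V) (v u : V) : G.dist v u ≤ ecc G v :=
  Finset.le_sup (f := fun u => G.dist v u) (Finset.mem_univ u)

lemma bn_le_alpha {V : Type*} [Fintype V] (G : SimpleGraph V) (g : V → ℕ) (hg : IsBnIndep G g) :
    ∑ v, g v ≤ alphaBn G := by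
  refine le_csSup ⟨∑ v, ecc G v, ?_⟩ ⟨g, hg, rfl⟩
  rintro _ ⟨h, hh, rfl⟩
  exact Finset.sum_le_sum fun v _ => hh.1 v

/-- Replace the broadcast from `v` by broadcasts from `u` and `z`. -/
lemma bn_replace {V : Type*} [Fintype V] (T : SimpleGraph V) (f : V → ℕ) (hf : IsBnIndep T f)
    (hmax : ∑ v, f v = alphaBn T) (u v z : V) (s t : ℕ) (huv : u ≠ v) (huz : u ≠ z)
    (hfu : f u = 0) (hz : (z = v ∧ t = 0) ∨ (z ≠ v ∧ f z = 0))
    (hs : s ≤ ecc T u) (ht : t ≤ ecc T z)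
    (hu : ∀ w, w ≠ v → 1 ≤ f w → s + f w ≤ T.dist u w)
    (hzw : ∀ w, w ≠ v → 1 ≤ f w → 1 ≤ t → t + f w ≤ T.dist z w)
    (hst : 1 ≤ t → s + t ≤ T.dist u z) : s + t ≤ f v := by
  classical
  set g : V → ℕ := fun x => if x = u then s else if x = z then t else if x = v then 0 else f x
    with hgdef
  have gu : g u = s := by simp [hgdef]
  have gz : g z = t := by simp [hgdef, huz.symm]
  have gx : ∀ x, x ≠ u → x ≠ z → 1 ≤ g x → x ≠ v ∧ g x = f x := by
    intro x h1 h2 h3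
    simp only [hgdef, h1, h2, if_false] at h3 ⊢
    split_ifs at h3 ⊢ <;> simp_all
  have hg : IsBnIndep T g := by
    constructor
    · intro x
      simp only [hgdef]
      split_ifs with h1 h2 h3
      · rw [h1]; exact hs
      · rw [h2]; exact ht
      · exact Nat.zero_le _
      · exact hf.1 x
    · intro x y hxy h1 h2
      by_cases hxu : x = u
      · subst hxu
        by_cases hyz : y = z
        · subst hyz
          rw [gu, gz]; exact hst (gz ▸ h2)
        · obtain ⟨a, b⟩ := gx y hxy.symm hyz h2
          rw [gu, b]; exact hu y a (b ▸ h2)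
      by_cases hyu : y = u
      · subst hyu
        rw [T.dist_comm, add_comm]
        by_cases hxz : x = z
        · subst hxz
          rw [gu, gz]; exact hst (gz ▸ h1)
        · obtain ⟨a, b⟩ := gx x hxu hxz h1
          rw [gu, b]; exact hu x a (b ▸ h1)
      by_cases hxz : x = z
      · subst hxz
        obtain ⟨a, b⟩ := gx y hyu hxy.symm h2
        rw [gz, b]; exact hzw y a (b ▸ h2) (gz ▸ h1)
      by_cases hyz : y = z
      · subst hyz
        obtain ⟨a, b⟩ := gx x hxu hxz h1
        rw [T.dist_comm, add_comm, gz, b]; exact hzw x a (b ▸ h1) (gz ▸ h2)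
      obtain ⟨a, b⟩ := gx x hxu hxz h1
      obtain ⟨a', b'⟩ := gx y hyu hyz h2
      rw [b, b']
      exact hf.2 x y hxy (b ▸ h1) (b' ▸ h2)
  have hle := bn_le_alpha T g hg
  rw [← hmax] at hle
  have hsum : ∑ x, (g x + if x = v then f v else 0) =
      ∑ x, (f x + (if x = u then s else 0) + (if x = z then t else 0)) := by
    refine Finset.sum_congr rfl fun x _ => ?_
    simp only [hgdef]
    by_cases h1 : x = u
    · subst h1; simp [huv, huz, hfu]
    by_cases h2 : x = z
    · subst h2
      rcases hz with ⟨h, h'⟩ | ⟨h, h'⟩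
      · subst h; simp [h1, h']
      · simp [h1, h, h']
    by_cases h3 : x = v
    · subst h3; simp [h1, h2]
    · simp [h1, h2, h3]
  simp only [Finset.sum_add_distrib, Finset.sum_ite_eq', Finset.mem_univ, if_true] at hsum
  omega

theorem leaf_hears_no_nonleaf {V : Type*} [Fintype V]
    (T : SimpleGraph V) [DecidableRel T.Adj] (hT : T.IsTree)
    (hn : 2 ≤ Fintype.card V)
    (f : V → ℕ) (hf : IsBnIndep T f) (hmax : ∑ v, f v = alphaBn T) :
    ∀ u v : V, T.degree u = 1 → T.degree v ≠ 1 → 1 ≤ f v →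
      f v < T.dist u v := by
  classical
  intro u v hdu hdv hfv
  by_contra hcon
  have hC := hT.connected
  have comm : ∀ x y, T.dist x y = T.dist y x := fun x y => T.dist_comm
  have tri : ∀ x y z, T.dist x z ≤ T.dist x y + T.dist y z := fun x y z => hC.dist_triangle
  have huv : u ≠ v := by rintro rfl; exact hdv hdu
  have hl : 1 ≤ T.dist v u := hC.pos_dist_of_ne huv.symm
  have hlk : T.dist v u ≤ f v := by rw [comm]; omega
  -- other broadcasting vertices are far away
  have hfar : ∀ w, w ≠ v → 1 ≤ f w → f v + f w ≤ T.dist v w := fun w h1 h2 =>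
    hf.2 v w h1.symm hfv h2
  have hnear : ∀ x, x ≠ v → T.dist v x ≤ f v → f x = 0 := by
    intro x h1 h2
    by_contra h
    have := hfar x h1 (by omega)
    omega
  -- a vertex at distance exactly f v
  have hex : ∃ y, T.dist v y = f v := by
    obtain ⟨w, -, hw⟩ := Finset.exists_mem_eq_sup Finset.univ ⟨v, Finset.mem_univ v⟩
      (fun x => T.dist v x)
    have : f v ≤ T.dist v w := by
      have := hf.1 v
      unfold ecc at this
      rw [hw] at this; exact this
    obtain ⟨y, hy, -⟩ := bn_interm hC v w _ this
    exact ⟨y, hy⟩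
  by_cases hcase : ∃ b, T.Adj v b ∧ ∀ y, T.dist v y = f v → T.dist b y = f v + 1
  · obtain ⟨b, hb, hby⟩ := hcase
    have hd1 : T.dist v b = 1 := SimpleGraph.dist_eq_one_iff_adj.2 hb
    obtain ⟨y0, hy0⟩ := hex
    have := bn_replace T f hf hmax b v v (f v + 1) 0 hb.ne.symm hb.ne.symm
      (hnear b hb.ne.symm (by omega)) (Or.inl ⟨rfl, rfl⟩)
      (by rw [← hby y0 hy0]; exact bn_le_ecc T b y0) (Nat.zero_le _)
      (by
        intro w h1 h2
        have h3 := hfar w h1 h2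
        obtain ⟨y, e1, e2, e3⟩ := bn_exit hT v w (f v) (by omega)
        have e4 := e3 b (by omega)
        have e5 := hby y e1
        omega)
      (by intros; omega) (by intros; omega)
    omega
  · push Not at hcase
    obtain ⟨p, hup, hpu⟩ := SimpleGraph.degree_eq_one_iff_existsUnique_adj.1 hdu
    have hleaf : ∀ x, x ≠ u → T.dist u x = 1 + T.dist p x := by
      intro x hx
      obtain ⟨q, h1, h2⟩ := bn_interm hC u x 1 (hC.pos_dist_of_ne hx.symm)
      have := hpu q (SimpleGraph.dist_eq_one_iff_adj.1 h1)
      rw [← this]; exact h2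
    have hpv : T.dist u v = 1 + T.dist p v := hleaf v huv.symm
    obtain ⟨a, ha, hau⟩ := bn_interm hC v u 1 hl
    have hva : T.Adj v a := SimpleGraph.dist_eq_one_iff_adj.1 ha
    obtain ⟨b, hvb, hba⟩ : ∃ b, T.Adj v b ∧ b ≠ a := by
      by_contra h
      push Not at h
      exact hdv (SimpleGraph.degree_eq_one_iff_existsUnique_adj.2 ⟨a, hva, h⟩)
    have hvb1 : T.dist v b = 1 := SimpleGraph.dist_eq_one_iff_adj.2 hvb
    have hab : T.dist a b = T.dist a v + 1 := by
      rcases hT.dist_eq_dist_add_one_of_adj a hvb with h | h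
      · exfalso
        have : T.dist a b = 0 := by have := comm a v; omega
        exact hba (hC.dist_eq_zero_iff.1 this).symm
      · exact h
    have hub : T.dist u b = T.dist u v + 1 := by
      rcases hT.dist_eq_dist_add_one_of_adj u hvb with h | h
      · exfalso
        have := bn_edge hT hvb hab (w := u) (by rw [comm v u, comm b u]; exact h)
        have := comm a v
        have := comm u v
        have := comm u b
        omega
      · exact h
    obtain ⟨yb, hyb1, hyb2⟩ := hcase b hvb
    have hyb3 : T.dist v yb = T.dist b yb + 1 := by
      have := comm v yb
      have := comm b yb
      rcases hT.dist_eq_dist_add_one_of_adj yb hvb with h | h <;> omega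
    have huyb := bn_edge hT hvb hub hyb3
    have hybu : yb ≠ u := by
      rintro rfl
      rw [T.dist_self] at huyb
      omega
    -- the nearest exit
    obtain ⟨y1, hy1, hmin⟩ := Finset.exists_min_image
      (Finset.univ.filter fun y => T.dist v y = f v ∧ y ≠ u) (fun y => T.dist u y)
      ⟨yb, by simp [hyb1, hybu]⟩
    simp only [Finset.mem_filter, Finset.mem_univ, true_and] at hy1 hmin
    obtain ⟨s, hs⟩ : ∃ s, s = T.dist u y1 := ⟨_, rfl⟩
    have hs1 : s ≤ T.dist u yb := hs ▸ hmin yb ⟨hyb1, hybu⟩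
    have hs2 := hleaf y1 hy1.2
    have hs3 := tri v p y1
    have c1 := comm u v
    have c2 := comm p v
    obtain ⟨m, hm⟩ : ∃ m, m = (s + f v - T.dist v u + 1) / 2 := ⟨_, rfl⟩
    obtain ⟨z, hz1, hz2⟩ := bn_interm hC v yb m (by omega)
    have huz := tri u z yb
    have hzv : z ≠ v := by
      rintro rfl
      rw [T.dist_self] at hz1
      omega
    have hzu : u ≠ z := by
      rintro rfl
      rw [T.dist_self] at huz
      omega
    have := bn_replace T f hf hmax u v z s (f v - m) huv hzu
      (hnear u huv hlk) (Or.inr ⟨hzv, hnear z hzv (by omega)⟩)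
      (by rw [hs]; exact bn_le_ecc T u y1)
      (by
        have := bn_le_ecc T z yb
        omega)
      (by
        intro w h1 h2
        have h3 := hfar w h1 h2
        obtain ⟨y, e1, e2, e3⟩ := bn_exit hT v w (f v) (by omega)
        have hyu : y ≠ u := by
          rintro rfl
          have e4 := e3 p (by omega)
          have e5 := hleaf w (by
            rintro rfl
            have := hnear w huv hlk
            omega)
          omega
        have e4 := e3 u hlk
        have e5 := hmin y ⟨e1, hyu⟩
        omega)
      (by
        intro w h1 h2 _
        have h3 := hfar w h1 h2
        have := tri v z w
        omega)
      (by intro _; omega)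
    omega
end

section
/- Let C be a caterpillar with no trunks (every vertex is a leaf or a branch vertex) and |V(C)| ≥ 3. Then α_bn(C) ≥ |L_C| + α(C[R_C]). -/
open SimpleGraph Finset

/-- The diameter of a graph: the maximum distance between two vertices. -/
noncomputable def gdiam {V : Type*} [Fintype V] (G : SimpleGraph V) : ℕ :=
  Finset.univ.sup fun u => Finset.univ.sup fun v => G.dist u v

/-- A caterpillar: a tree with a diametrical path `p` such that every vertex
lies on `p` or is adjacent to a vertex of `p`. -/
def IsCaterpillar {V : Type*} [Fintype V] (G : SimpleGraph V) : Prop :=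
  G.IsTree ∧ ∃ (u v : V) (p : G.Walk u v), p.IsPath ∧ p.length = gdiam G ∧
    ∀ w : V, w ∈ p.support ∨ ∃ x ∈ p.support, G.Adj w x

/-- `R_C`: the set of branch vertices `b` such that at most one leaf `l` satisfies
that every path from another branch vertex to `l` passes through `b`. -/
def RSet {V : Type*} [Fintype V] (G : SimpleGraph V) [DecidableRel G.Adj] : Set V :=
  {b | 3 ≤ G.degree b ∧
    {l : V | G.degree l = 1 ∧ ∀ b' : V, 3 ≤ G.degree b' → b' ≠ b →
      ∀ p : G.Walk b' l, p.IsPath → b ∈ p.support}.ncard ≤ 1}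

section helpers
variable {V : Type*} [Fintype V] (C : SimpleGraph V) [DecidableRel C.Adj]

lemma leaf_unique {l b c : V} (hl : C.degree l = 1) (hb : C.Adj l b) (hc : C.Adj l c) :
    b = c :=
  (degree_eq_one_iff_existsUnique_adj.mp hl).unique hb hc

lemma leaf_dist (hC : C.Connected) {l b v : V} (hl : C.degree l = 1) (hb : C.Adj l b)
    (hv : v ≠ l) : 1 + C.dist b v ≤ C.dist l v := by
  obtain ⟨w, hw⟩ := hC.exists_walk_length_eq_dist l v
  cases w with
  | nil => exact absurd rfl hv
  | cons h q =>
    obtain rfl := leaf_unique C hl hb h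
    have := SimpleGraph.dist_le q
    simp at hw
    omega

lemma leaf_nbr (hC : C.Connected) (hn : 3 ≤ Fintype.card V) {l b : V} (hl : C.degree l = 1)
    (hb : C.Adj l b) : C.degree b ≠ 1 := by
  classical
  intro h
  have : (Finset.univ : Finset V) ⊆ {l, b} := by
    intro v _
    by_contra hv
    simp at hv
    have h1 := leaf_dist C hC hl hb hv.1
    have h2 := leaf_dist C hC h hb.symm hv.2
    omega
  have h3 := Finset.card_le_card this
  have h4 := Finset.card_le_two (a := l) (b := b)
  rw [Finset.card_univ] at h3
  omega

lemma leaf_leaf (hC : C.Connected) (hn : 3 ≤ Fintype.card V) {l b l' b' : V}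
    (hl : C.degree l = 1) (hb : C.Adj l b) (hl' : C.degree l' = 1) (hb' : C.Adj l' b')
    (hne : l ≠ l') : 2 + C.dist b b' ≤ C.dist l l' := by
  have h1 := leaf_dist C hC hl hb hne.symm
  have : b ≠ l' := by
    rintro rfl
    exact leaf_nbr C hC hn hl hb hl'
  have h2 := leaf_dist C hC hl' hb' this
  rw [SimpleGraph.dist_comm (u := b'), SimpleGraph.dist_comm (u := l')] at h2
  omega

lemma leaf_ecc (hC : C.Connected) (hn : 3 ≤ Fintype.card V) {l b : V}
    (hl : C.degree l = 1) (hb : C.Adj l b) : 2 ≤ ecc C l := by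
  classical
  obtain ⟨v, hv⟩ : ∃ v, v ∉ ({l, b} : Finset V) := by
    by_contra! h
    have h3 := Finset.card_le_card (fun v _ => h v : (Finset.univ : Finset V) ⊆ {l, b})
    have h4 := Finset.card_le_two (a := l) (b := b)
    rw [Finset.card_univ] at h3
    omega
  simp at hv
  have h1 := leaf_dist C hC hl hb hv.1
  have h2 := hC.pos_dist_of_ne (Ne.symm hv.2)
  have : C.dist l v ≤ ecc C l := Finset.le_sup (f := fun u => C.dist l u) (Finset.mem_univ v)
  omega

/-- two neighbours of `w` cannot be joined avoiding `w`. -/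
lemma no_detour (hC : C.IsAcyclic) {w x y : V} (hx : C.Adj w x) (hy : C.Adj w y) (hne : x ≠ y)
    (q : C.Walk x y) (hq : w ∉ q.support) : False := by
  classical
  have hp : (Walk.cons hx.symm (Walk.cons hy Walk.nil)).IsPath := by
    simp [hx.ne', hy.ne, hne]
  have := congrArg (fun r : C.Path x y => r.1.support) (hC.path_unique q.toPath ⟨_, hp⟩)
  simp only at this
  apply hq
  apply q.support_toPath_subset
  rw [this]
  simp

lemma snd_of_adj (hC : C.IsAcyclic) {b v x : V} (q : C.Walk b v) (hq : q.IsPath)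
    (hx : x ∈ q.support) (hb : C.Adj b x) : x = q.snd := by
  classical
  have hp : (Walk.cons hb Walk.nil).IsPath := by simp [hb.ne]
  have := congrArg (fun r : C.Path b x => r.1.length)
    (hC.path_unique ⟨q.takeUntil x hx, hq.takeUntil hx⟩ ⟨_, hp⟩)
  simp only [Walk.length_cons, Walk.length_nil] at this
  have h2 := Walk.getVert_length_takeUntil hx
  rw [this] at h2
  exact h2.symm

lemma walk_in {u v x y : V} (p : C.Walk u v) (hx : x ∈ p.support) (hy : y ∈ p.support) :
    ∃ q : C.Walk x y, q.support ⊆ p.support := by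
  classical
  refine ⟨(p.takeUntil x hx).reverse.append (p.takeUntil y hy), ?_⟩
  intro z hz
  rw [Walk.mem_support_append_iff, Walk.support_reverse, List.mem_reverse] at hz
  rcases hz with hz | hz
  · exact p.support_takeUntil_subset_support hx hz
  · exact p.support_takeUntil_subset_support hy hz

lemma off_leaf (hC : C.IsAcyclic) {u v : V} (p : C.Walk u v)
    (hcat : ∀ w : V, w ∈ p.support ∨ ∃ x ∈ p.support, C.Adj w x) {w : V} (hw : w ∉ p.support) :
    C.degree w = 1 := by
  rw [degree_eq_one_iff_existsUnique_adj]
  obtain ⟨y, hy, hwy⟩ := (hcat w).resolve_left hw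
  refine ⟨y, hwy, fun x hx => ?_⟩
  by_contra hne
  rcases hcat x with hxp | ⟨z, hz, hxz⟩
  · obtain ⟨q, hq⟩ := walk_in C p hxp hy
    exact no_detour C hC hx hwy hne q (fun h => hw (hq h))
  · obtain ⟨q, hq⟩ := walk_in C p hz hy
    refine no_detour C hC hx hwy hne (Walk.cons hxz q) ?_
    simp only [Walk.support_cons, List.mem_cons, not_or]
    exact ⟨hx.ne, fun h => hw (hq h)⟩

lemma exists_leaf (hC : IsCaterpillar C) {b : V} (hb : 3 ≤ C.degree b) :
    ∃ l, C.degree l = 1 ∧ C.Adj l b := by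
  classical
  obtain ⟨ht, u, v, p, hp, -, hcat⟩ := hC
  have hbp : b ∈ p.support := by
    by_contra h
    have := off_leaf C ht.isAcyclic p hcat h
    omega
  obtain ⟨x, hx, hx'⟩ : ∃ x ∈ C.neighborFinset b,
      x ∉ ({(p.takeUntil b hbp).reverse.snd, (p.dropUntil b hbp).snd} : Finset V) := by
    by_contra! h
    have h3 := Finset.card_le_card (h : C.neighborFinset b ⊆ _)
    have h4 := Finset.card_le_two (a := (p.takeUntil b hbp).reverse.snd)
      (b := (p.dropUntil b hbp).snd)
    rw [card_neighborFinset_eq_degree] at h3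
    omega
  rw [mem_neighborFinset] at hx
  simp only [Finset.mem_insert, Finset.mem_singleton, not_or] at hx'
  refine ⟨x, off_leaf C ht.isAcyclic p hcat fun hxp => ?_, hx.symm⟩
  rw [← p.take_spec hbp, Walk.mem_support_append_iff] at hxp
  rcases hxp with h | h
  · exact hx'.1 (snd_of_adj C ht.isAcyclic _ (hp.takeUntil hbp).reverse (by simpa using h) hx)
  · exact hx'.2 (snd_of_adj C ht.isAcyclic _ (hp.dropUntil hbp) h hx)

lemma R_leaf_unique {b l l' : V} (hb : b ∈ RSet C) (hl : C.degree l = 1)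
    (hlb : C.Adj l b) (hl' : C.degree l' = 1) (hlb' : C.Adj l' b) : l = l' := by
  have key : ∀ l, C.degree l = 1 → C.Adj l b → l ∈ {l : V | C.degree l = 1 ∧
      ∀ b' : V, 3 ≤ C.degree b' → b' ≠ b → ∀ p : C.Walk b' l, p.IsPath → b ∈ p.support} := by
    intro l hl hlb
    refine ⟨hl, fun b' hb' _ p _ => ?_⟩
    have : b ∈ p.reverse.support := by
      cases h : p.reverse with
      | nil => omega
      | cons hadj q =>
        obtain rfl := leaf_unique C hl hlb hadj
        simp
    simpa using this
  exact (Set.ncard_le_one (Set.toFinite _)).mp hb.2 _ (key l hl hlb) _ (key l' hl' hlb')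

end helpers

theorem alphaBn_caterpillar_no_trunks_lower {V : Type*} [Fintype V]
    (C : SimpleGraph V) [DecidableRel C.Adj]
    (hC : IsCaterpillar C) (htrunk : ∀ v : V, C.degree v ≠ 2)
    (hn : 3 ≤ Fintype.card V) :
    (Finset.univ.filter fun v => C.degree v = 1).card +
      sSup {k | ∃ s : Finset V, ↑s ⊆ RSet C ∧
        (∀ u ∈ s, ∀ v ∈ s, u ≠ v → ¬ C.Adj u v) ∧ s.card = k}
      ≤ alphaBn C := by
  classical
  have hcon := hC.1.isConnected
  set S := {k | ∃ s : Finset V, ↑s ⊆ RSet C ∧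
        (∀ u ∈ s, ∀ v ∈ s, u ≠ v → ¬ C.Adj u v) ∧ s.card = k} with hS
  have hmem : sSup S ∈ S := by
    apply Nat.sSup_mem
    · exact ⟨0, ∅, by simp⟩
    · refine ⟨Fintype.card V, ?_⟩
      rintro k ⟨s, -, -, rfl⟩
      exact Finset.card_le_univ s
  obtain ⟨s, hsR, hsI, hsc⟩ := hmem
  rw [← hsc]
  have hex : ∀ b : V, ∃ l, b ∈ s → C.degree l = 1 ∧ C.Adj l b := by
    intro b
    by_cases hb : b ∈ s
    · obtain ⟨l, hl⟩ := exists_leaf C hC (hsR hb).1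
      exact ⟨l, fun _ => hl⟩
    · exact ⟨b, fun h => absurd h hb⟩
  choose g hg using hex
  have hinj : Set.InjOn g s := by
    intro b hb c hc h
    have h1 := hg b hb
    have h2 := hg c hc
    rw [← h] at h2
    exact leaf_unique C h1.1 h1.2 h2.2
  let f : V → ℕ := fun v => (if C.degree v = 1 then 1 else 0) + (if v ∈ s.image g then 1 else 0)
  have hf : ∀ v, 1 ≤ f v → ∃ b, C.degree v = 1 ∧ C.Adj v b ∧
      (f v = 1 ∨ (f v = 2 ∧ b ∈ s)) := by
    intro v hv
    by_cases h : v ∈ s.image g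
    · obtain ⟨b, hb, rfl⟩ := Finset.mem_image.mp h
      have h1 := hg b hb
      exact ⟨b, h1.1, h1.2, Or.inr ⟨by simp only [f, if_pos h, if_pos h1.1], hb⟩⟩
    · simp only [f, if_neg h] at hv ⊢
      by_cases hd : C.degree v = 1
      · obtain ⟨b, hb, -⟩ := degree_eq_one_iff_existsUnique_adj.mp hd
        exact ⟨b, hd, hb, Or.inl (by simp [hd])⟩
      · simp [hd] at hv
  have hbn : IsBnIndep C f := by
    constructor
    · intro v
      by_cases hv : 1 ≤ f v
      · obtain ⟨b, hd, hb, h⟩ := hf v hv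
        have := leaf_ecc C hcon hn hd hb
        rcases h with h | h <;> omega
      · omega
    · intro u v huv hu hv
      obtain ⟨b, hd, hb, h⟩ := hf u hu
      obtain ⟨c, hd', hc, h'⟩ := hf v hv
      have hD := leaf_leaf C hcon hn hd hb hd' hc huv
      by_cases hbc : b = c
      · subst hbc
        have hbs : b ∉ s := fun hbs => huv (R_leaf_unique C (hsR hbs) hd hb hd' hc)
        have h1 : f u = 1 := h.resolve_right fun h => hbs h.2
        have h2 : f v = 1 := h'.resolve_right fun h => hbs h.2
        omega
      · have hpos := hcon.pos_dist_of_ne hbc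
        rcases h with h | ⟨h, hbs⟩ <;> rcases h' with h' | ⟨h', hcs⟩ <;> try omega
        have h1 : C.dist b c ≠ 1 := fun h => hsI b hbs c hcs hbc (SimpleGraph.dist_eq_one_iff_adj.mp h)
        omega
  have hsum : ∑ v, f v = (Finset.univ.filter fun v => C.degree v = 1).card + s.card := by
    simp only [f, Finset.sum_add_distrib, Finset.sum_boole, Nat.cast_id]
    rw [← Finset.card_image_of_injOn hinj]
    congr 2
    ext v
    simp
  apply le_csSup
  · refine ⟨∑ v, ecc C v, ?_⟩
    rintro k ⟨f, hf, rfl⟩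
    exact Finset.sum_le_sum fun v _ => hf.1 v
  · exact ⟨f, hbn, hsum⟩
end
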